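/- Let n ≥ 2 and let D be a torsion-free affine connection on ℝⁿ, with Patterson–Walker metric g on ℝ^{2n}. Then the Ricci curvature of g is totally isotropic with respect to g: at every point of ℝ^{2n}, ∑_{k,l} Ric(g)_{ik} (g^{-1})^{kl} Ric(g)_{lj} = 0 for all indices i, j. -/

import Mathlib

open scoped BigOperators

/-- Partial derivative of a function on `ι → ℝ` in coordinate direction `i`. -/
noncomputable def pd {ι : Type} [Fintype ι] [DecidableEq ι] (i : ι)
    (f : (ι → ℝ) → ℝ) (x : ι → ℝ) : ℝ :=
  fderiv ℝ f x (Pi.single i 1)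

/-- Ricci curvature of an affine connection given by coefficients `Γ k i j`. -/
noncomputable def ricConn {ι : Type} [Fintype ι] [DecidableEq ι]
    (Γ : ι → ι → ι → (ι → ℝ) → ℝ) (i j : ι) (x : ι → ℝ) : ℝ :=
  (∑ k, pd k (fun y => Γ k i j y) x) - (∑ k, pd i (fun y => Γ k k j y) x)
    + ∑ k, ∑ l, (Γ k k l x * Γ l i j x - Γ k i l x * Γ l k j x)

/-- Levi-Civita Christoffel symbols of a metric in coordinates. -/
noncomputable def christoffel {ι : Type} [Fintype ι] [DecidableEq ι]
    (G : (ι → ℝ) → Matrix ι ι ℝ) (k i j : ι) (x : ι → ℝ) : ℝ :=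
  (1/2) * ∑ l, (G x)⁻¹ k l *
    (pd i (fun y => G y j l) x + pd j (fun y => G y i l) x - pd l (fun y => G y i j) x)

/-- Laplacian of a metric in coordinates, applied to a function. -/
noncomputable def laplacian {ι : Type} [Fintype ι] [DecidableEq ι]
    (G : (ι → ℝ) → Matrix ι ι ℝ) (F : (ι → ℝ) → ℝ) (x : ι → ℝ) : ℝ :=
  ∑ i, ∑ j, (G x)⁻¹ i j *
    (pd i (fun y => pd j F y) x - ∑ k, christoffel G k i j x * pd k F x)

/-- Lie derivative of a metric along a vector field, in coordinates. -/
noncomputable def lieDeriv {ι : Type} [Fintype ι] [DecidableEq ι]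
    (X : ι → (ι → ℝ) → ℝ) (G : (ι → ℝ) → Matrix ι ι ℝ) (i j : ι) (x : ι → ℝ) : ℝ :=
  (∑ k, X k x * pd k (fun y => G y i j) x)
  + (∑ k, pd i (X k) x * G x k j) + ∑ k, pd j (X k) x * G x i k

/-- Index type for the ambient space: `t`, `x^A`, `p_A`, `ρ`. -/
abbrev AmbIdx (n : ℕ) : Type := Unit ⊕ (Fin n ⊕ (Fin n ⊕ Unit))

def it (n : ℕ) : AmbIdx n := Sum.inl ()
def ix {n : ℕ} (A : Fin n) : AmbIdx n := Sum.inr (Sum.inl A)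
def ip {n : ℕ} (A : Fin n) : AmbIdx n := Sum.inr (Sum.inr (Sum.inl A))
def irho (n : ℕ) : AmbIdx n := Sum.inr (Sum.inr (Sum.inr ()))

/-- The `x`-coordinates of an ambient point. -/
def xc {n : ℕ} (u : AmbIdx n → ℝ) : Fin n → ℝ := fun A => u (ix A)

/-- The ambient metric of the affine connection `Γ`. -/
noncomputable def ambientMetric (n : ℕ) (Γ : Fin n → Fin n → Fin n → (Fin n → ℝ) → ℝ)
    (u : AmbIdx n → ℝ) : Matrix (AmbIdx n) (AmbIdx n) ℝ :=
  Matrix.of fun a b =>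
    match a, b with
    | Sum.inl _, Sum.inl _ => 2 * u (irho n)
    | Sum.inl _, Sum.inr (Sum.inr (Sum.inr _)) => u (it n)
    | Sum.inr (Sum.inr (Sum.inr _)), Sum.inl _ => u (it n)
    | Sum.inr (Sum.inl A), Sum.inr (Sum.inr (Sum.inl B)) =>
        (u (it n))^2 * (if A = B then (1:ℝ) else 0)
    | Sum.inr (Sum.inr (Sum.inl A)), Sum.inr (Sum.inl B) =>
        (u (it n))^2 * (if A = B then (1:ℝ) else 0)
    | Sum.inr (Sum.inl A), Sum.inr (Sum.inl B) =>
        (u (it n))^2 * (-2 * ∑ C, u (ip C) * Γ C A B (xc u)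
          + (2 * u (irho n) / ((n:ℝ) - 1)) * ricConn Γ A B (xc u))
    | _, _ => 0

/-- The Patterson–Walker metric of a torsion-free affine connection with
coefficients `Γ`, on the doubled space with coordinates `(x, y)`. -/
noncomputable def pwGen {ι : Type} [Fintype ι] [DecidableEq ι]
    (Γ : ι → ι → ι → (ι → ℝ) → ℝ) (u : (ι ⊕ ι) → ℝ) : Matrix (ι ⊕ ι) (ι ⊕ ι) ℝ :=
  Matrix.of fun a b =>
    match a, b with
    | Sum.inl i, Sum.inl j => -2 * ∑ k, u (Sum.inr k) * Γ k i j (fun l => u (Sum.inl l))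
    | Sum.inl i, Sum.inr j => if i = j then (1:ℝ) else 0
    | Sum.inr i, Sum.inl j => if i = j then (1:ℝ) else 0
    | Sum.inr _, Sum.inr _ => 0

/-- `D` preserves a volume form: there is a smooth positive `v` with
`∑_C Γ^C_{AC} = ∂_A (log v)`. -/
def PreservesVolume (n : ℕ) (Γ : Fin n → Fin n → Fin n → (Fin n → ℝ) → ℝ) : Prop :=
  ∃ v : (Fin n → ℝ) → ℝ, ContDiff ℝ (⊤ : ℕ∞) v ∧ (∀ x, 0 < v x) ∧
    ∀ (A : Fin n) (x : Fin n → ℝ), (∑ C, Γ C A C x) = pd A (fun y => Real.log (v y)) x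

/-- Index type for the Thomas cone: `x^0` and `x^A`. -/
abbrev ThIdx (n : ℕ) : Type := Unit ⊕ Fin n

/-- The Thomas cone connection of the affine connection `Γ`. -/
noncomputable def thomasConn (n : ℕ) (Γ : Fin n → Fin n → Fin n → (Fin n → ℝ) → ℝ) :
    ThIdx n → ThIdx n → ThIdx n → ((ThIdx n) → ℝ) → ℝ := fun c a b u =>
  match c, a, b with
  | Sum.inr C, Sum.inr A, Sum.inr B => Γ C A B (fun E => u (Sum.inr E))
  | Sum.inl _, Sum.inr A, Sum.inr B =>
      -(u (Sum.inl ()) / ((n:ℝ) - 1)) * ricConn Γ A B (fun E => u (Sum.inr E))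
  | Sum.inr B, Sum.inr A, Sum.inl _ => if A = B then 1 / u (Sum.inl ()) else 0
  | Sum.inr B, Sum.inl _, Sum.inr A => if A = B then 1 / u (Sum.inl ()) else 0
  | _, _, _ => 0

section PattersonWalker

variable {ι : Type} [Fintype ι] [DecidableEq ι] {Γ : ι → ι → ι → (ι → ℝ) → ℝ}

lemma pd_const (i : ι) (c : ℝ) (x : ι → ℝ) : pd i (fun _ => c) x = 0 := by
  simp [pd]

lemma pwGen_eq_fromBlocks (Γ : ι → ι → ι → (ι → ℝ) → ℝ) (u : ι ⊕ ι → ℝ) :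
    pwGen Γ u = Matrix.fromBlocks (pwGen Γ u).toBlocks₁₁ 1 1 0 := by
  ext (a | a) (b | b) <;> simp [pwGen, Matrix.toBlocks₁₁, Matrix.one_apply]

lemma pwGen_inv (Γ : ι → ι → ι → (ι → ℝ) → ℝ) (u : ι ⊕ ι → ℝ) :
    (pwGen Γ u)⁻¹ = Matrix.fromBlocks 0 1 1 (-(pwGen Γ u).toBlocks₁₁) := by
  apply Matrix.inv_eq_right_inv
  conv_lhs => rw [pwGen_eq_fromBlocks]
  simp [Matrix.fromBlocks_multiply]

/-- A function of the base coordinates is constant along the fibres. -/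
lemma pd_inr_comp_base {f : (ι → ℝ) → ℝ} (hf : Differentiable ℝ f) (i : ι) (u : ι ⊕ ι → ℝ) :
    pd (Sum.inr i) (fun y : ι ⊕ ι → ℝ => f fun l => y (Sum.inl l)) u = 0 := by
  let L : (ι ⊕ ι → ℝ) →L[ℝ] (ι → ℝ) :=
    ContinuousLinearMap.pi fun l => ContinuousLinearMap.proj (Sum.inl l)
  have h : HasFDerivAt (fun y : ι ⊕ ι → ℝ => f (L y)) ((fderiv ℝ f (L u)).comp L) u :=
    (hf (L u)).hasFDerivAt.comp u L.hasFDerivAt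
  have hL : L (Pi.single (Sum.inr i) 1) = 0 := by
    ext l
    simp [L]
  change fderiv ℝ (fun y => f (L y)) u _ = 0
  rw [h.fderiv]
  simp [hL]

/-- The fibre derivatives of the base block of the Patterson–Walker metric. -/
lemma pd_inr_pwGen_inl_inl (hΓ : ∀ k i j, Differentiable ℝ (Γ k i j)) (c a b : ι)
    (u : ι ⊕ ι → ℝ) :
    pd (Sum.inr c) (fun y => pwGen Γ y (Sum.inl a) (Sum.inl b)) u =
      -2 * Γ c a b (fun l => u (Sum.inl l)) := by
  have hd (k : ι) : DifferentiableAt ℝ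
      (fun y : ι ⊕ ι → ℝ => Γ k a b fun l => y (Sum.inl l)) u :=
    (hΓ k a b _).comp u (by fun_prop)
  have hp (k : ι) := pd_inr_comp_base (hΓ k a b) c u
  have h := HasFDerivAt.const_mul (HasFDerivAt.fun_sum (u := Finset.univ) fun k _ =>
    (hasFDerivAt_apply (𝕜 := ℝ) (Sum.inr k) u).mul (hd k).hasFDerivAt) (-2 : ℝ)
  simp only [pd] at hp ⊢
  refine (DFunLike.congr_fun h.fderiv _).trans ?_
  simp [hp, Pi.single_apply]

lemma pd_pwGen_inl_inr (i : ι ⊕ ι) (a b : ι) (u : ι ⊕ ι → ℝ) :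
    pd i (fun y => pwGen Γ y (Sum.inl a) (Sum.inr b)) u = 0 :=
  pd_const ..

lemma pd_pwGen_inr_inl (i : ι ⊕ ι) (a b : ι) (u : ι ⊕ ι → ℝ) :
    pd i (fun y => pwGen Γ y (Sum.inr a) (Sum.inl b)) u = 0 :=
  pd_const ..

lemma pd_pwGen_inr_inr (i : ι ⊕ ι) (a b : ι) (u : ι ⊕ ι → ℝ) :
    pd i (fun y => pwGen Γ y (Sum.inr a) (Sum.inr b)) u = 0 :=
  pd_const ..

lemma christoffel_pwGen_inl_inl_inl (hΓ : ∀ k i j, Differentiable ℝ (Γ k i j)) (k a b : ι)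
    (u : ι ⊕ ι → ℝ) :
    christoffel (pwGen Γ) (Sum.inl k) (Sum.inl a) (Sum.inl b) u =
      Γ k a b (fun l => u (Sum.inl l)) := by
  simp [christoffel, pwGen_inv, pd_pwGen_inl_inr, pd_inr_pwGen_inl_inl hΓ, Matrix.one_apply]

lemma christoffel_pwGen_inl_inr_left (k a : ι) (j : ι ⊕ ι) (u : ι ⊕ ι → ℝ) :
    christoffel (pwGen Γ) (Sum.inl k) (Sum.inr a) j u = 0 := by
  rcases j with b | b <;>
  simp [christoffel, pwGen_inv, pd_pwGen_inl_inr, pd_pwGen_inr_inl, pd_pwGen_inr_inr]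

lemma christoffel_pwGen_inl_inr_right (k b : ι) (i : ι ⊕ ι) (u : ι ⊕ ι → ℝ) :
    christoffel (pwGen Γ) (Sum.inl k) i (Sum.inr b) u = 0 := by
  rcases i with a | a <;>
  simp [christoffel, pwGen_inv, pd_pwGen_inl_inr, pd_pwGen_inr_inl, pd_pwGen_inr_inr]

lemma christoffel_pwGen_inr_inr_inr (k a b : ι) (u : ι ⊕ ι → ℝ) :
    christoffel (pwGen Γ) (Sum.inr k) (Sum.inr a) (Sum.inr b) u = 0 := by
  simp [christoffel, pd_pwGen_inr_inl, pd_pwGen_inr_inr]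

lemma christoffel_pwGen_inr_inl_inr (hΓ : ∀ k i j, Differentiable ℝ (Γ k i j)) (k a b : ι)
    (u : ι ⊕ ι → ℝ) :
    christoffel (pwGen Γ) (Sum.inr k) (Sum.inl a) (Sum.inr b) u =
      -Γ b a k (fun l => u (Sum.inl l)) := by
  simp [christoffel, pwGen_inv, pd_pwGen_inl_inr, pd_pwGen_inr_inl, pd_pwGen_inr_inr,
    pd_inr_pwGen_inl_inl hΓ, Matrix.one_apply]

lemma christoffel_pwGen_inr_inr_inl (hΓ : ∀ k i j, Differentiable ℝ (Γ k i j)) (k a b : ι)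
    (u : ι ⊕ ι → ℝ) :
    christoffel (pwGen Γ) (Sum.inr k) (Sum.inr a) (Sum.inl b) u =
      -Γ a b k (fun l => u (Sum.inl l)) := by
  simp [christoffel, pwGen_inv, pd_pwGen_inl_inr, pd_pwGen_inr_inl, pd_pwGen_inr_inr,
    pd_inr_pwGen_inl_inl hΓ, Matrix.one_apply]

lemma ricConn_christoffel_pwGen_inr_left (hΓ : ∀ k i j, Differentiable ℝ (Γ k i j)) (a : ι)
    (j : ι ⊕ ι) (u : ι ⊕ ι → ℝ) :
    ricConn (christoffel (pwGen Γ)) (Sum.inr a) j u = 0 := by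
  have hneg (c k i j : ι) :
      pd (Sum.inr c) (fun y : ι ⊕ ι → ℝ => -Γ k i j fun l => y (Sum.inl l)) u = 0 :=
    pd_inr_comp_base (f := fun x => -Γ k i j x) (hΓ k i j).neg c u
  rcases j with b | b <;>
  simp [ricConn, christoffel_pwGen_inl_inl_inl hΓ, christoffel_pwGen_inl_inr_left,
    christoffel_pwGen_inl_inr_right, christoffel_pwGen_inr_inr_inr,
    christoffel_pwGen_inr_inr_inl hΓ, hneg, pd_inr_comp_base (hΓ _ _ _), pd_const]

lemma ricConn_christoffel_pwGen_inr_right (hΓ : ∀ k i j, Differentiable ℝ (Γ k i j)) (b : ι)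
    (i : ι ⊕ ι) (u : ι ⊕ ι → ℝ) :
    ricConn (christoffel (pwGen Γ)) i (Sum.inr b) u = 0 := by
  have hneg (c k i j : ι) :
      pd (Sum.inr c) (fun y : ι ⊕ ι → ℝ => -Γ k i j fun l => y (Sum.inl l)) u = 0 :=
    pd_inr_comp_base (f := fun x => -Γ k i j x) (hΓ k i j).neg c u
  rcases i with a | a
  · simp [ricConn, christoffel_pwGen_inl_inr_right, christoffel_pwGen_inr_inr_inr,
      christoffel_pwGen_inr_inl_inr hΓ, hneg, pd_const]
  · exact ricConn_christoffel_pwGen_inr_left hΓ a _ u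

end PattersonWalker

/-- The Ricci curvature of the Patterson–Walker metric is totally
isotropic with respect to the metric. -/
theorem pw_metric_ricci_totally_isotropic
    (n : ℕ) (hn : 2 ≤ n) (Γ : Fin n → Fin n → Fin n → (Fin n → ℝ) → ℝ)
    (hsmooth : ∀ C A B, ContDiff ℝ (⊤ : ℕ∞) (Γ C A B))
    (hsym : ∀ C A B x, Γ C A B x = Γ C B A x) :
    ∀ (u : (Fin n ⊕ Fin n) → ℝ) (i j : Fin n ⊕ Fin n),
      ∑ k, ∑ l, ricConn (christoffel (pwGen Γ)) i k u * (pwGen Γ u)⁻¹ k l *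
        ricConn (christoffel (pwGen Γ)) l j u = 0 := by
  intro u i j
  have hΓ (C A B : Fin n) : Differentiable ℝ (Γ C A B) := (hsmooth C A B).differentiable (by simp)
  simp [pwGen_inv, ricConn_christoffel_pwGen_inr_left hΓ, ricConn_christoffel_pwGen_inr_right hΓ]
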